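/- For every real h, F_1(h) = Φ(h)² − φ(h)·[hΦ(h) + φ(h)], where F_1(h) is the probability that the Slepian process stays below h on the time interval [0,1]. -/

import Mathlib

open MeasureTheory ProbabilityTheory Real Set Filter

/-- The standard normal density `φ(x) = (2π)^{-1/2} exp(-x²/2)`. -/
noncomputable def stdPhi (x : ℝ) : ℝ := (Real.sqrt (2 * Real.pi))⁻¹ * Real.exp (-x ^ 2 / 2)

/-- The standard normal distribution function `Φ(x) = ∫_{-∞}^x φ(t) dt`. -/
noncomputable def stdCdf (x : ℝ) : ℝ := ∫ t in Set.Iic x, stdPhi t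

/-- `S` is a Slepian process on the probability space `(Ω, μ)`: a stationary Gaussian
process with continuous sample paths, mean zero and covariance
`E[S(t)S(t')] = max 0 (1 - |t - t'|)` (e.g. `S(t) = W(t+1) - W(t)` for a standard
Brownian motion `W`). -/
def IsSlepian {Ω : Type*} [MeasurableSpace Ω] (μ : Measure Ω) (S : ℝ → Ω → ℝ) : Prop :=
  IsProbabilityMeasure μ ∧
  (∀ t, Measurable (S t)) ∧
  (∀ ω, Continuous fun t => S t ω) ∧
  (∀ (n : ℕ) (t c : Fin n → ℝ), ∃ v : NNReal,
      Measure.map (fun ω => ∑ i, c i * S (t i) ω) μ = gaussianReal 0 v) ∧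
  (∀ t, ∫ ω, S t ω ∂μ = 0) ∧
  (∀ t t', ∫ ω, S t ω * S t' ω ∂μ = max 0 (1 - |t - t'|))

/-- `F_T(h)`: the probability that the process `S` stays below `h` on `[0, T]`. -/
noncomputable def slepF {Ω : Type*} [MeasurableSpace Ω] (μ : Measure Ω)
    (S : ℝ → Ω → ℝ) (T h : ℝ) : ℝ :=
  (μ {ω | ∀ t ∈ Set.Icc (0 : ℝ) T, S t ω < h}).toReal

/-- The two-term linear combination `S(a) + c S(b)` attached to `p = (a, c, b)`. -/
def slepComb {Ω : Type*} (S : ℝ → Ω → ℝ) (p : ℝ × ℝ × ℝ) (ω : Ω) : ℝ :=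
  S p.1 ω + p.2.1 * S p.2.2 ω

/-- The covariance of two combinations `slepComb`. -/
noncomputable def slepCombCov (p q : ℝ × ℝ × ℝ) : ℝ :=
  max 0 (1 - |p.1 - q.1|) + q.2.1 * max 0 (1 - |p.1 - q.2.2|) +
    p.2.1 * max 0 (1 - |p.2.2 - q.1|) + p.2.1 * q.2.1 * max 0 (1 - |p.2.2 - q.2.2|)

section Slepian

variable {Ω : Type*} [MeasurableSpace Ω] {μ : Measure Ω} {S : ℝ → Ω → ℝ}

theorem IsSlepian.isGaussianProcess (hS : IsSlepian μ S) : IsGaussianProcess S μ := by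
  obtain ⟨hp, hm, -, hg, -, -⟩ := hS
  refine ⟨fun I => ⟨?_⟩⟩
  have hmI : Measurable (fun ω => I.restrict (S · ω)) := by
    refine measurable_pi_lambda _ fun i => hm i
  refine isGaussian_of_map_eq_gaussianReal fun L => ?_
  obtain ⟨v, hv⟩ := hg I.card (fun i => (I.equivFin.symm i : ℝ))
    (fun i => L (fun j => if I.equivFin.symm i = j then 1 else 0))
  refine ⟨0, v, ?_⟩
  rw [Measure.map_map L.continuous.measurable hmI, ← hv]
  congr 1
  ext ω
  rw [← I.equivFin.sum_comp]
  simp only [Equiv.symm_apply_apply, Function.comp]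
  refine (L.toLinearMap.pi_apply_eq_sum_univ _).trans (Finset.sum_congr rfl fun i _ => ?_)
  rw [smul_eq_mul, mul_comm]
  rfl

theorem IsSlepian.isGaussianProcess_slepComb (hS : IsSlepian μ S) :
    IsGaussianProcess (slepComb S) μ := by
  classical
  exact hS.isGaussianProcess.of_isGaussianProcess fun p => ⟨{p.1, p.2.2},
    { toFun x := x ⟨p.1, by simp⟩ + p.2.1 * x ⟨p.2.2, by simp⟩
      map_add' x y := by simp; ring
      map_smul' c x := by simp; ring },
    by simp [slepComb]⟩

theorem IsSlepian.measurable_slepComb (hS : IsSlepian μ S) (p : ℝ × ℝ × ℝ) :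
    Measurable (slepComb S p) :=
  (hS.2.1 _).add ((hS.2.1 _).const_mul _)

theorem IsSlepian.memLp_two (hS : IsSlepian μ S) (t : ℝ) : MemLp (S t) 2 μ :=
  (hS.isGaussianProcess.hasGaussianLaw_eval t).memLp_two

theorem IsSlepian.integral_slepComb (hS : IsSlepian μ S) (p : ℝ × ℝ × ℝ) :
    ∫ ω, slepComb S p ω ∂μ = 0 := by
  have hi (t : ℝ) : Integrable (S t) μ :=
    (hS.isGaussianProcess.hasGaussianLaw_eval t).integrable
  unfold slepComb
  rw [integral_add (hi _) ((hi _).const_mul _), integral_const_mul]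
  simp [hS.2.2.2.2.1]

theorem IsSlepian.covariance_slepComb (hS : IsSlepian μ S) (p q : ℝ × ℝ × ℝ) :
    cov[slepComb S p, slepComb S q; μ] = slepCombCov p q := by
  have hp := hS.1
  have hi (s t : ℝ) : Integrable (fun ω => S s ω * S t ω) μ :=
    (hS.memLp_two s).integrable_mul (hS.memLp_two t)
  have hmem (p : ℝ × ℝ × ℝ) : MemLp (slepComb S p) 2 μ :=
    (hS.memLp_two _).add ((hS.memLp_two _).const_mul _)
  rw [covariance_eq_sub (hmem p) (hmem q), hS.integral_slepComb, zero_mul, sub_zero]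
  have : (slepComb S p * slepComb S q) = fun ω =>
      ((S p.1 ω * S q.1 ω + q.2.1 * (S p.1 ω * S q.2.2 ω)) +
        p.2.1 * (S p.2.2 ω * S q.1 ω)) + p.2.1 * q.2.1 * (S p.2.2 ω * S q.2.2 ω) := by
    ext ω
    simp only [Pi.mul_apply, slepComb]
    ring
  rw [this, integral_add, integral_add, integral_add, integral_const_mul, integral_const_mul,
    integral_const_mul]
  · simp only [hS.2.2.2.2.2, slepCombCov]
  all_goals first
    | exact hi _ _
    | exact (hi _ _).const_mul _
    | exact (hi _ _).add ((hi _ _).const_mul _)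
    | exact ((hi _ _).add ((hi _ _).const_mul _)).add ((hi _ _).const_mul _)

theorem IsSlepian.map_slepComb (hS : IsSlepian μ S) (p : ℝ × ℝ × ℝ) :
    μ.map (slepComb S p) = gaussianReal 0 (slepCombCov p p).toNNReal := by
  rw [(hS.isGaussianProcess_slepComb.hasGaussianLaw_eval p).map_eq_gaussianReal,
    hS.integral_slepComb, ← covariance_self (hS.measurable_slepComb p).aemeasurable,
    hS.covariance_slepComb]

theorem IsSlepian.indepFun_slepComb (hS : IsSlepian μ S) {T T' : Type*}
    (p : T → ℝ × ℝ × ℝ) (q : T' → ℝ × ℝ × ℝ) (h : ∀ s t, slepCombCov (p s) (q t) = 0) :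
    IndepFun (fun ω s => slepComb S (p s) ω) (fun ω t => slepComb S (q t) ω) μ := by
  refine IsGaussianProcess.indepFun_of_covariance_eq_zero
    (X := fun s => slepComb S (p s)) (Y := fun t => slepComb S (q t)) ?_
    (fun s => (hS.measurable_slepComb _).aemeasurable)
    (fun s => (hS.measurable_slepComb _).aemeasurable)
    (fun s t => (hS.covariance_slepComb _ _).trans (h s t))
  convert! hS.isGaussianProcess_slepComb.comp_right (Sum.elim p q) using 1
  ext (s | t) <;> rfl

end Slepian

/-- The supremum of a function on `[0, 1]` over the rational points. -/
noncomputable def unitSup (w : Icc (0 : ℝ) 1 → ℝ) : ℝ :=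
  ⨆ q : {q : ℚ // (q : ℝ) ∈ Icc (0 : ℝ) 1}, w ⟨q, q.2⟩

theorem measurable_unitSup : Measurable unitSup :=
  Measurable.iSup fun q => measurable_pi_apply (⟨q, q.2⟩ : Icc (0 : ℝ) 1)

theorem unitSup_le_iff {f : ℝ → ℝ} (hf : Continuous f) {c : ℝ} :
    unitSup (fun t => f t) ≤ c ↔ ∀ t ∈ Icc (0 : ℝ) 1, f t ≤ c := by
  have : Nonempty {q : ℚ // (q : ℝ) ∈ Icc (0 : ℝ) 1} := ⟨⟨0, by simp⟩⟩
  constructor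
  · intro hc t ht
    have hbdd : BddAbove (range fun q : {q : ℚ // (q : ℝ) ∈ Icc (0 : ℝ) 1} => f q) := by
      refine (isCompact_Icc.image hf (s := Icc (0 : ℝ) 1)).bddAbove.mono ?_
      rintro _ ⟨q, rfl⟩
      exact ⟨q, q.2, rfl⟩
    have hsub : Ioo (0 : ℝ) 1 ∩ range ((↑) : ℚ → ℝ) ⊆ {t | f t ≤ c} := by
      rintro _ ⟨hq, q, rfl⟩
      exact (le_ciSup hbdd ⟨q, Ioo_subset_Icc_self hq⟩).trans hc
    have hcl : IsClosed {t | f t ≤ c} := isClosed_le hf continuous_const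
    have h1 : Ioo (0 : ℝ) 1 ⊆ {t | f t ≤ c} :=
      (Rat.denseRange_cast.open_subset_closure_inter isOpen_Ioo).trans
        (closure_minimal hsub hcl)
    have h2 := closure_minimal h1 hcl
    rw [closure_Ioo zero_ne_one] at h2
    exact h2 ht
  · intro hc
    exact ciSup_le fun q => hc q q.2

theorem unitSup_lt_iff {f : ℝ → ℝ} (hf : Continuous f) {c : ℝ} :
    unitSup (fun t => f t) < c ↔ ∀ t ∈ Icc (0 : ℝ) 1, f t < c := by
  constructor
  · intro hc t ht
    exact ((unitSup_le_iff hf).1 le_rfl t ht).trans_lt hc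
  · intro hc
    obtain ⟨t, ht, hmax⟩ :=
      isCompact_Icc.exists_isMaxOn (nonempty_Icc.2 zero_le_one) hf.continuousOn
    exact ((unitSup_le_iff hf).2 hmax).trans_lt (hc t ht)

/-- `j / (n + 1)` is the first grid point at which `f` exceeds `m`. -/
def FirstExceeds (f : ℝ → ℝ) (m : ℝ) (n j : ℕ) : Prop :=
  (∀ i : Fin j, f ((i : ℕ) / (n + 1 : ℝ)) ≤ m) ∧ m < f (j / (n + 1 : ℝ))

theorem FirstExceeds.unique {f : ℝ → ℝ} {m : ℝ} {n j j' : ℕ} (h : FirstExceeds f m n j)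
    (h' : FirstExceeds f m n j') : j = j' := by
  rcases lt_trichotomy j j' with hlt | heq | hlt
  · exact absurd h.2 (h'.1 ⟨j, hlt⟩).not_gt
  · exact heq
  · exact absurd h'.2 (h.1 ⟨j', hlt⟩).not_gt

theorem div_succ_mem_Icc {n j : ℕ} (hj : j ≤ n + 1) : (j / (n + 1 : ℝ)) ∈ Icc (0 : ℝ) 1 := by
  refine ⟨by positivity, div_le_one_of_le₀ (by exact_mod_cast hj) (by positivity)⟩

theorem eventually_firstExceeds {f : ℝ → ℝ} (hf : Continuous f) {m : ℝ} (h0 : f 0 ≤ m)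
    (hm : ∃ t ∈ Icc (0 : ℝ) 1, m < f t) {ε : ℝ} (hε : 0 < ε) :
    ∀ᶠ n : ℕ in atTop, ∃ j ≤ n + 1, FirstExceeds f m n j ∧ f (j / (n + 1 : ℝ)) < m + ε := by
  obtain ⟨t, ht, hmt⟩ := hm
  have huc : UniformContinuousOn f (Icc 0 1) :=
    isCompact_Icc.uniformContinuousOn_of_continuous hf.continuousOn
  obtain ⟨δ, hδ, hδf⟩ := Metric.uniformContinuousOn_iff.1 huc (min ε (f t - m))
    (lt_min hε (sub_pos.2 hmt))
  obtain ⟨n₀, hn₀⟩ := exists_nat_one_div_lt hδ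
  filter_upwards [eventually_ge_atTop n₀] with n hn
  have hnp : (0 : ℝ) < n + 1 := by positivity
  have hnδ : 1 / (n + 1 : ℝ) < δ := by
    refine lt_of_le_of_lt ?_ hn₀
    gcongr
  have hex : ∃ j : ℕ, m < f (j / (n + 1 : ℝ)) ∧ j ≤ n + 1 := by
    have hfl : (⌊t * (n + 1)⌋₊ : ℝ) ≤ t * (n + 1) := Nat.floor_le (mul_nonneg ht.1 hnp.le)
    have hfl' : t * (n + 1) < ⌊t * (n + 1)⌋₊ + 1 := Nat.lt_floor_add_one _
    have hle : ⌊t * (n + 1)⌋₊ ≤ n + 1 := by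
      have : (⌊t * (n + 1)⌋₊ : ℝ) ≤ n + 1 := hfl.trans (by nlinarith [ht.2])
      exact_mod_cast this
    refine ⟨⌊t * (n + 1)⌋₊, ?_, hle⟩
    have hd : dist ((⌊t * (n + 1)⌋₊ : ℝ) / (n + 1)) t < δ := by
      refine lt_of_le_of_lt ?_ hnδ
      rw [Real.dist_eq, abs_le]
      constructor
      · rw [← sub_nonneg]
        have : (⌊t * (n + 1)⌋₊ : ℝ) / (n + 1) - t - -(1 / (n + 1)) =
          (⌊t * (n + 1)⌋₊ + 1 - t * (n + 1)) / (n + 1) := by field_simp; ring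
        rw [this]
        exact div_nonneg (by linarith) hnp.le
      · have : (⌊t * (n + 1)⌋₊ : ℝ) / (n + 1) ≤ t := by
          rw [div_le_iff₀ hnp]; exact hfl
        have : 0 < 1 / (n + 1 : ℝ) := by positivity
        linarith
    have h2 := hδf _ (div_succ_mem_Icc hle) t ht hd
    rw [Real.dist_eq] at h2
    have h3 := (abs_lt.1 (h2.trans_le (min_le_right _ _))).1
    linarith
  classical
  refine ⟨Nat.find hex, (Nat.find_spec hex).2, ⟨fun i => ?_, (Nat.find_spec hex).1⟩, ?_⟩
  · have := Nat.find_min hex i.2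
    by_contra hcon
    exact this ⟨not_le.1 hcon, i.2.le.trans (Nat.find_spec hex).2⟩
  · have hle := (Nat.find_spec hex).2
    have hpos : Nat.find hex ≠ 0 := by
      intro h
      have := (Nat.find_spec hex).1
      rw [h] at this
      simp at this
      linarith
    obtain ⟨j, hj⟩ := Nat.exists_eq_succ_of_ne_zero hpos
    have hprev : f (j / (n + 1 : ℝ)) ≤ m := by
      by_contra hcon
      exact Nat.find_min hex (hj ▸ Nat.lt_succ_self j) ⟨not_le.1 hcon, by omega⟩
    have hd : dist ((Nat.find hex : ℝ) / (n + 1)) (j / (n + 1 : ℝ)) < δ := by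
      rw [hj, Real.dist_eq, ← sub_div, Nat.cast_succ, add_sub_cancel_left,
        abs_of_pos (by positivity)]
      exact hnδ
    have h2 := hδf _ (div_succ_mem_Icc hle) _ (div_succ_mem_Icc (by omega)) hd
    rw [Real.dist_eq] at h2
    have h3 := (abs_lt.1 (h2.trans_le (min_le_left _ _))).2
    linarith

section Reflection

variable {Ω : Type*} [MeasurableSpace Ω] {μ : Measure Ω} [IsProbabilityMeasure μ] {V : ℝ → Ω → ℝ}

theorem measurableSet_firstExceeds (hVm : ∀ t, Measurable (V t)) (m : ℝ) (n j : ℕ) :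
    MeasurableSet {ω | FirstExceeds (V · ω) m n j} := by
  have h1 : MeasurableSet {ω | ∀ i : Fin j, V ((i : ℕ) / (n + 1 : ℝ)) ω ≤ m} := by
    rw [ofPred_forall]
    exact MeasurableSet.iInter fun i => measurableSet_le (hVm _) measurable_const
  exact h1.inter (measurableSet_lt measurable_const (hVm _))

/-- Reflecting the path after the grid time `j / (n + 1)` preserves integrals over the event that
this is the first time at which the level `m` is exceeded. -/
theorem lintegral_firstExceeds_reflect (hVm : ∀ t, Measurable (V t))
    (hind : ∀ s ∈ Icc (0 : ℝ) 1,
      IndepFun (fun ω (u : Icc 0 s) => V u ω) (fun ω => V 1 ω - V s ω) μ)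
    (hsym : ∀ s ∈ Icc (0 : ℝ) 1,
      μ.map (fun ω => V 1 ω - V s ω) = μ.map (fun ω => -(V 1 ω - V s ω)))
    {G : ℝ → ENNReal} (hG : Measurable G) (m : ℝ) {n j : ℕ} (hj : j ≤ n + 1) :
    ∫⁻ ω, {ω | FirstExceeds (V · ω) m n j}.indicator (fun ω => G (V 1 ω)) ω ∂μ =
      ∫⁻ ω, {ω | FirstExceeds (V · ω) m n j}.indicator
        (fun ω => G (2 * V (j / (n + 1 : ℝ)) ω - V 1 ω)) ω ∂μ := by
  set s : ℝ := j / (n + 1 : ℝ) with hs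
  have hs01 : s ∈ Icc (0 : ℝ) 1 := div_succ_mem_Icc hj
  have hmem (i : Fin j) : ((i : ℕ) / (n + 1 : ℝ)) ∈ Icc 0 s := by
    refine ⟨by positivity, ?_⟩
    rw [hs]
    gcongr
    exact i.2.le
  have hss : s ∈ Icc 0 s := ⟨hs01.1, le_rfl⟩
  set B : Set (Icc 0 s → ℝ) := {w | (∀ i : Fin j, w ⟨_, hmem i⟩ ≤ m) ∧ m < w ⟨s, hss⟩}
  have hB : MeasurableSet B := by
    have h1 : MeasurableSet {w : Icc 0 s → ℝ | ∀ i : Fin j, w ⟨_, hmem i⟩ ≤ m} := by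
      rw [ofPred_forall]
      exact MeasurableSet.iInter fun i => measurableSet_le (measurable_pi_apply _) measurable_const
    exact h1.inter (measurableSet_lt measurable_const (measurable_pi_apply _))
  set Φ : (Icc 0 s → ℝ) × ℝ → ENNReal :=
    (B ×ˢ univ).indicator (fun p => G (p.1 ⟨s, hss⟩ + p.2))
  have hΦ : Measurable Φ := by
    refine Measurable.indicator ?_ (hB.prod MeasurableSet.univ)
    exact hG.comp (((measurable_pi_apply _).comp measurable_fst).add measurable_snd)
  have hP : Measurable (fun ω (u : Icc 0 s) => V u ω) := measurable_pi_lambda _ fun u => hVm _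
  have hD : Measurable (fun ω => V 1 ω - V s ω) := (hVm 1).sub (hVm s)
  have e1 := (indepFun_iff_map_prod_eq_prod_map_map hP.aemeasurable hD.aemeasurable).1
    (hind s hs01)
  have hD' : Measurable (fun ω => -(V 1 ω - V s ω)) := hD.neg
  have e2 := (indepFun_iff_map_prod_eq_prod_map_map hP.aemeasurable hD'.aemeasurable).1
    ((hind s hs01).comp measurable_id measurable_neg)
  have key : ∫⁻ ω, Φ (fun u => V u ω, V 1 ω - V s ω) ∂μ =
      ∫⁻ ω, Φ (fun u => V u ω, -(V 1 ω - V s ω)) ∂μ := by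
    rw [← lintegral_map hΦ (hP.prodMk hD), e1, ← lintegral_map hΦ (hP.prodMk hD'), hsym s hs01]
    exact congrArg (fun ν => lintegral ν Φ) e2.symm
  convert key using 2 with ω ω
  · ext ω
    simp only [Φ, indicator, B, mem_ofPred_eq, mem_prod, mem_univ, and_true, FirstExceeds,
      add_sub_cancel, ← hs]
  · ext ω
    simp only [Φ, indicator, B, mem_ofPred_eq, mem_prod, mem_univ, and_true, FirstExceeds, ← hs]
    rw [show V s ω + -(V 1 ω - V s ω) = 2 * V s ω - V 1 ω by ring]

theorem sum_firstExceeds_eq {f : ℝ → ℝ} {m : ℝ} {n j : ℕ} (hj : j ≤ n + 1)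
    (h : FirstExceeds f m n j) (a : ℕ → ENNReal) :
    ∑ i ∈ Finset.range (n + 2), {g | FirstExceeds g m n i}.indicator (fun _ => a i) f = a j := by
  rw [Finset.sum_eq_single j]
  · exact indicator_of_mem (s := {g | FirstExceeds g m n j}) h _
  · intro i _ hij
    exact indicator_of_notMem (s := {g | FirstExceeds g m n i}) (fun hi => hij (hi.unique h)) _
  · intro hj'
    simp only [Finset.mem_range] at hj'
    omega

theorem sum_firstExceeds_le {f : ℝ → ℝ} {m : ℝ} {n : ℕ} {a : ℕ → ENNReal} {C : ENNReal}
    (ha : ∀ i, a i ≤ C) :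
    ∑ i ∈ Finset.range (n + 2), {g | FirstExceeds g m n i}.indicator (fun _ => a i) f ≤ C := by
  by_cases h : ∃ j ≤ n + 1, FirstExceeds f m n j
  · obtain ⟨j, hj, hfj⟩ := h
    rw [sum_firstExceeds_eq hj hfj]
    exact ha j
  · rw [Finset.sum_eq_zero]
    · exact zero_le
    · intro i hi
      refine indicator_of_notMem (s := {g | FirstExceeds g m n i}) (fun hi' => h ⟨i, ?_, hi'⟩) _
      simp only [Finset.mem_range] at hi
      omega

/-- The reflection principle, in the form of an identity between integrals. -/
theorem lintegral_reflection (hVm : ∀ t, Measurable (V t)) (hVc : ∀ ω, Continuous fun t => V t ω)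
    (hV0 : ∀ ω, V 0 ω = 0)
    (hind : ∀ s ∈ Icc (0 : ℝ) 1,
      IndepFun (fun ω (u : Icc 0 s) => V u ω) (fun ω => V 1 ω - V s ω) μ)
    (hsym : ∀ s ∈ Icc (0 : ℝ) 1,
      μ.map (fun ω => V 1 ω - V s ω) = μ.map (fun ω => -(V 1 ω - V s ω)))
    {m : ℝ} (hm : 0 ≤ m) (hatom : ∀ᵐ ω ∂μ, V 1 ω ≠ m)
    {k : ℝ → ENNReal} (hk : Continuous k) {C : ENNReal} (hC : C ≠ ⊤) (hkC : ∀ x, k x ≤ C) :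
    ∫⁻ ω, {ω | ∃ t ∈ Icc (0 : ℝ) 1, m < V t ω}.indicator
        (fun ω => (Iio m).indicator k (V 1 ω)) ω ∂μ =
      ∫⁻ ω, (Ioi m).indicator (fun v => k (2 * m - v)) (V 1 ω) ∂μ := by
  set G : ℝ → ENNReal := (Iio m).indicator k with hGdef
  have hG : Measurable G := hk.measurable.indicator measurableSet_Iio
  have hGC (x : ℝ) : G x ≤ C := (indicator_le_self _ _ x).trans (hkC x)
  have hGcont {y : ℝ} (hy : y ≠ m) : ContinuousAt G y := by
    rcases lt_or_gt_of_ne hy with hy | hy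
    · refine hk.continuousAt.congr ?_
      filter_upwards [Iio_mem_nhds hy] with x hx
      exact (indicator_of_mem hx _).symm
    · refine (continuousAt_const (y := (0 : ENNReal))).congr ?_
      filter_upwards [Ioi_mem_nhds hy] with x hx
      exact (indicator_of_notMem (s := Iio m) (f := k) (not_lt.2 (le_of_lt (mem_Ioi.1 hx)))).symm
  set F₁ : ℕ → Ω → ENNReal := fun n ω => ∑ i ∈ Finset.range (n + 2),
    {g | FirstExceeds g m n i}.indicator (fun _ => G (V 1 ω)) (V · ω) with hF₁
  set F₂ : ℕ → Ω → ENNReal := fun n ω => ∑ i ∈ Finset.range (n + 2),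
    {g | FirstExceeds g m n i}.indicator
      (fun _ => G (2 * V (i / (n + 1 : ℝ)) ω - V 1 ω)) (V · ω) with hF₂
  have hmeas {n i : ℕ} {g : Ω → ENNReal} (hg : Measurable g) :
      Measurable fun ω => {g | FirstExceeds g m n i}.indicator (fun _ => g ω) (V · ω) :=
    hg.indicator (measurableSet_firstExceeds hVm m n i)
  have hg₁ : Measurable fun ω => G (V 1 ω) := hG.comp (hVm 1)
  have hg₂ (n i : ℕ) : Measurable fun ω => G (2 * V (i / (n + 1 : ℝ)) ω - V 1 ω) :=
    hG.comp (((hVm _).const_mul 2).sub (hVm 1))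
  have heq (n : ℕ) : ∫⁻ ω, F₁ n ω ∂μ = ∫⁻ ω, F₂ n ω ∂μ := by
    simp only [hF₁, hF₂]
    rw [lintegral_finsetSum _ fun i _ => hmeas hg₁,
      lintegral_finsetSum _ fun i _ => hmeas (hg₂ n i)]
    refine Finset.sum_congr rfl fun i hi => ?_
    simp only [Finset.mem_range] at hi
    exact lintegral_firstExceeds_reflect hVm hind hsym hG m (by omega)
  have hzero {ω : Ω} (hω : ¬ ∃ t ∈ Icc (0 : ℝ) 1, m < V t ω) (n : ℕ) (a : ℕ → ENNReal) :
      ∑ i ∈ Finset.range (n + 2),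
        {g | FirstExceeds g m n i}.indicator (fun _ => a i) (V · ω) = 0 := by
    refine Finset.sum_eq_zero fun i hi => ?_
    refine indicator_of_notMem (s := {g | FirstExceeds g m n i}) (fun hi' => hω ?_) _
    simp only [Finset.mem_range] at hi
    exact ⟨_, div_succ_mem_Icc (by omega), hi'.2⟩
  have hlim₁ : Tendsto (fun n => ∫⁻ ω, F₁ n ω ∂μ) atTop
      (nhds (∫⁻ ω, {ω | ∃ t ∈ Icc (0 : ℝ) 1, m < V t ω}.indicator (fun ω => G (V 1 ω)) ω ∂μ)) := by
    refine tendsto_lintegral_of_dominated_convergence (fun _ => C)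
      (fun n => Finset.measurable_fun_sum _ fun i _ => hmeas hg₁)
      (fun n => .of_forall fun ω => sum_firstExceeds_le fun _ => hGC _) (by simpa using hC)
      (.of_forall fun ω => ?_)
    by_cases hω : ∃ t ∈ Icc (0 : ℝ) 1, m < V t ω
    · rw [indicator_of_mem (show ω ∈ {ω | ∃ t ∈ Icc (0 : ℝ) 1, m < V t ω} from hω)]
      refine tendsto_const_nhds.congr' ?_
      filter_upwards [eventually_firstExceeds (hVc ω) ((hV0 ω).trans_le hm) hω one_pos]
        with n ⟨j, hj, hfj, _⟩
      exact (sum_firstExceeds_eq hj hfj fun _ => G (V 1 ω)).symm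
    · rw [indicator_of_notMem (show ω ∉ {ω | ∃ t ∈ Icc (0 : ℝ) 1, m < V t ω} from hω)]
      exact tendsto_const_nhds.congr fun n => (hzero hω n _).symm
  have hlim₂ : Tendsto (fun n => ∫⁻ ω, F₂ n ω ∂μ) atTop
      (nhds (∫⁻ ω, (Ioi m).indicator (fun v => k (2 * m - v)) (V 1 ω) ∂μ)) := by
    refine tendsto_lintegral_of_dominated_convergence (fun _ => C)
      (fun n => Finset.measurable_fun_sum _ fun i _ => hmeas (hg₂ n i))
      (fun n => .of_forall fun ω => sum_firstExceeds_le fun _ => hGC _) (by simpa using hC) ?_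
    filter_upwards [hatom] with ω hatom
    have hval : (Ioi m).indicator (fun v => k (2 * m - v)) (V 1 ω) = G (2 * m - V 1 ω) := by
      simp only [hGdef, indicator, mem_Ioi, mem_Iio]
      congr 1
      exact propext ⟨fun h => by linarith, fun h => by linarith⟩
    by_cases hω : ∃ t ∈ Icc (0 : ℝ) 1, m < V t ω
    · rw [hval]
      intro U hU
      obtain ⟨ε, hε, hεU⟩ := Metric.mem_nhds_iff.1
        (hGcont (y := 2 * m - V 1 ω) (fun h => hatom (by linarith)) hU)
      rw [mem_map]
      filter_upwards [eventually_firstExceeds (hVc ω) ((hV0 ω).trans_le hm) hω (half_pos hε)]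
        with n ⟨j, hj, hfj, hlt⟩
      simp only [mem_preimage, hF₂]
      rw [sum_firstExceeds_eq hj hfj fun i => G (2 * V (i / (n + 1 : ℝ)) ω - V 1 ω)]
      refine hεU ?_
      have := hfj.2
      rw [Metric.mem_ball, Real.dist_eq, abs_lt]
      constructor <;> linarith
    · rw [indicator_of_notMem]
      · exact tendsto_const_nhds.congr fun n => (hzero hω n _).symm
      · exact fun h => hω ⟨1, by simp, h⟩
  exact tendsto_nhds_unique (hlim₁.congr heq) hlim₂

end Reflection

theorem gaussianPDFReal_zero_one (x : ℝ) : gaussianPDFReal 0 1 x = stdPhi x := by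
  simp [gaussianPDFReal, stdPhi]

theorem integrable_stdPhi : Integrable stdPhi :=
  (integrable_gaussianPDFReal 0 1).congr (.of_forall gaussianPDFReal_zero_one)

theorem stdPhi_nonneg (x : ℝ) : 0 ≤ stdPhi x := by
  unfold stdPhi
  positivity

theorem stdCdf_nonneg (x : ℝ) : 0 ≤ stdCdf x :=
  integral_nonneg fun t => stdPhi_nonneg t

theorem gaussianReal_Iic (h : ℝ) : gaussianReal 0 1 (Iic h) = ENNReal.ofReal (stdCdf h) := by
  rw [gaussianReal_apply_eq_integral 0 one_ne_zero]
  simp only [gaussianPDFReal_zero_one, stdCdf]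

theorem hasDerivAt_stdPhi (x : ℝ) : HasDerivAt stdPhi (-x * stdPhi x) x := by
  have h1 : HasDerivAt (fun x : ℝ => -x ^ 2 / 2) (-x) x := by
    have := ((hasDerivAt_pow 2 x).neg).div_const 2
    convert! this using 1
    simp
    ring
  have h2 := (h1.exp).const_mul (Real.sqrt (2 * Real.pi))⁻¹
  convert! h2 using 1
  unfold stdPhi
  ring

theorem integrable_neg_mul_stdPhi : Integrable fun x => -x * stdPhi x := by
  have := (integrable_mul_exp_neg_mul_sq (b := 1 / 2) (by norm_num)).const_mul
    (-(Real.sqrt (2 * Real.pi))⁻¹)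
  refine this.congr (.of_forall fun x => ?_)
  simp only [stdPhi]
  rw [show -(1 / 2) * x ^ 2 = -x ^ 2 / 2 by ring]
  ring

theorem tendsto_stdPhi_atBot : Tendsto stdPhi atBot (nhds 0) := by
  have h := (tendsto_rpow_abs_mul_exp_neg_mul_sq_cocompact (a := 1 / 2) (by norm_num) 0).mono_left
    atBot_le_cocompact
  have h2 := h.const_mul (Real.sqrt (2 * Real.pi))⁻¹
  rw [mul_zero] at h2
  refine h2.congr fun x => ?_
  simp only [stdPhi, Real.rpow_zero, one_mul]
  rw [show -(1 / 2) * x ^ 2 = -x ^ 2 / 2 by ring]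

theorem integral_Iic_sub_mul_stdPhi (h : ℝ) :
    ∫ u in Iic h, (h - u) * stdPhi u = h * stdCdf h + stdPhi h := by
  have h1 : ∫ u in Iic h, -u * stdPhi u = stdPhi h := by
    rw [integral_Iic_of_hasDerivAt_of_tendsto' (fun x _ => hasDerivAt_stdPhi x)
      integrable_neg_mul_stdPhi.integrableOn tendsto_stdPhi_atBot, sub_zero]
  have h2 : (fun u => (h - u) * stdPhi u) = fun u => h * stdPhi u + -u * stdPhi u := by
    ext u
    ring
  rw [h2, integral_add (integrable_stdPhi.const_mul h).integrableOn
    integrable_neg_mul_stdPhi.integrableOn, integral_const_mul, h1, stdCdf]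

theorem mul_stdCdf_add_stdPhi_nonneg (h : ℝ) : 0 ≤ h * stdCdf h + stdPhi h := by
  rw [← integral_Iic_sub_mul_stdPhi]
  refine setIntegral_nonneg measurableSet_Iic fun u hu => ?_
  exact mul_nonneg (sub_nonneg.2 hu) (stdPhi_nonneg u)

theorem two_mul_gaussianPDFReal_mul (h v : ℝ) :
    gaussianPDFReal 0 2 v * (2 * gaussianPDFReal 0 2 (2 * h - v)) =
      stdPhi h * stdPhi (h - v) := by
  simp only [gaussianPDFReal, stdPhi, NNReal.coe_ofNat, sub_zero]
  have e : Real.exp (-v ^ 2 / (2 * 2)) * Real.exp (-(2 * h - v) ^ 2 / (2 * 2)) =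
      Real.exp (-h ^ 2 / 2) * Real.exp (-(h - v) ^ 2 / 2) := by
    rw [← Real.exp_add, ← Real.exp_add]
    congr 1
    ring
  have c : 2 * ((Real.sqrt (2 * Real.pi * 2))⁻¹ * (Real.sqrt (2 * Real.pi * 2))⁻¹) =
      (Real.sqrt (2 * Real.pi))⁻¹ * (Real.sqrt (2 * Real.pi))⁻¹ := by
    rw [← mul_inv, ← mul_inv, Real.mul_self_sqrt (by positivity),
      Real.mul_self_sqrt (by positivity)]
    field_simp
  linear_combination (2 * ((Real.sqrt (2 * Real.pi * 2))⁻¹ * (Real.sqrt (2 * Real.pi * 2))⁻¹)) * e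
    + Real.exp (-h ^ 2 / 2) * Real.exp (-(h - v) ^ 2 / 2) * c

theorem continuous_gaussianPDF (m : ℝ) (v : NNReal) : Continuous (gaussianPDF m v) := by
  unfold gaussianPDF gaussianPDFReal
  exact ENNReal.continuous_ofReal.comp (by fun_prop)

theorem gaussianPDF_le (x : ℝ) : gaussianPDF 0 2 x ≤ 1 := by
  unfold gaussianPDF gaussianPDFReal
  rw [ENNReal.ofReal_le_one]
  refine mul_le_one₀ (inv_le_one_of_one_le₀ ?_) (Real.exp_nonneg _) (Real.exp_le_one_iff.2 ?_)
  · rw [Real.one_le_sqrt]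
    push_cast
    nlinarith [Real.pi_gt_three]
  · rw [neg_div]
    exact neg_nonpos.2 (by positivity)

theorem lintegral_gaussianReal_reflected (h : ℝ) :
    ∫⁻ v, 2 * gaussianPDF 0 2 (2 * h - v) * ENNReal.ofReal v ∂(gaussianReal 0 2) =
      ENNReal.ofReal (stdPhi h * (h * stdCdf h + stdPhi h)) := by
  rw [gaussianReal_of_var_ne_zero 0 two_ne_zero,
    lintegral_withDensity_eq_lintegral_mul _ (measurable_gaussianPDF 0 2) (by
      refine (((measurable_gaussianPDF 0 2).comp
        (measurable_const.sub measurable_id)).const_mul 2).mul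
        ENNReal.measurable_ofReal)]
  have h1 (v : ℝ) : gaussianPDF 0 2 v * (2 * gaussianPDF 0 2 (2 * h - v) * ENNReal.ofReal v) =
      ENNReal.ofReal (stdPhi h * stdPhi (h - v)) * ENNReal.ofReal v := by
    rw [← two_mul_gaussianPDFReal_mul, ENNReal.ofReal_mul (gaussianPDFReal_nonneg 0 2 v),
      ENNReal.ofReal_mul zero_le_two, ENNReal.ofReal_ofNat, ← mul_assoc]
    rfl
  simp only [Pi.mul_apply, h1]
  rw [← lintegral_sub_left_eq_self _ h]
  have h2 (u : ℝ) : ENNReal.ofReal (stdPhi h * stdPhi (h - (h - u))) * ENNReal.ofReal (h - u) =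
      (Iic h).indicator (fun u => ENNReal.ofReal (stdPhi h * ((h - u) * stdPhi u))) u := by
    rw [sub_sub_cancel, ← ENNReal.ofReal_mul (mul_nonneg (stdPhi_nonneg _) (stdPhi_nonneg _))]
    by_cases hu : u ∈ Iic h
    · rw [indicator_of_mem hu]
      congr 1
      ring
    · rw [indicator_of_notMem hu, ENNReal.ofReal_eq_zero]
      refine mul_nonpos_of_nonneg_of_nonpos (mul_nonneg (stdPhi_nonneg _) (stdPhi_nonneg _)) ?_
      rw [mem_Iic, not_le] at hu
      linarith
  simp only [h2]
  rw [lintegral_indicator measurableSet_Iic, ← ofReal_integral_eq_lintegral_ofReal,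
    integral_const_mul, integral_Iic_sub_mul_stdPhi]
  · refine Integrable.const_mul ?_ _
    refine (((integrable_stdPhi.const_mul h).add integrable_neg_mul_stdPhi).congr
      (.of_forall fun u => ?_)).integrableOn
    simp only [Pi.add_apply]
    ring
  · refine (ae_restrict_iff' measurableSet_Iic).2 (.of_forall fun u hu => ?_)
    exact mul_nonneg (stdPhi_nonneg _) (mul_nonneg (sub_nonneg.2 hu) (stdPhi_nonneg u))

theorem lintegral_eq_two_mul_comp_affine {f : ℝ → ENNReal} (hf : Measurable f) (v : ℝ) :
    ∫⁻ z, f z = ∫⁻ x, 2 * f (2 * x + v) := by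
  have hfv : Measurable fun y => f (y + v) := hf.comp (measurable_id.add_const v)
  have hscale : ∫⁻ y, f (y + v) = 2 * ∫⁻ x, f (2 * x + v) := by
    conv_lhs => rw [← Real.smul_map_volume_mul_left (two_ne_zero (α := ℝ))]
    rw [lintegral_smul_measure, lintegral_map hfv (measurable_const_mul 2)]
    simp
  rw [← lintegral_add_right_eq_self f v, hscale]
  exact (lintegral_const_mul _ (hfv.comp (measurable_const_mul 2))).symm

/-- If `Z ~ N(0, 2)` is independent of `(M, v)`, then `((Z - v) / 2, M, v)` has density
`2 g(2x + v)`, with `g` the density of `Z`, relative to the product of Lebesgue measure with the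
law of `(M, v)`. -/
theorem lintegral_half_sub_eq {Ω : Type*} [MeasurableSpace Ω] {μ : Measure Ω}
    [IsProbabilityMeasure μ] {Z M v : Ω → ℝ} (hZm : Measurable Z) (hM : Measurable M)
    (hv : Measurable v) (hZ : μ.map Z = gaussianReal 0 2)
    (hind : IndepFun (fun ω => (M ω, v ω)) Z μ) {H : ℝ × ℝ × ℝ → ENNReal} (hH : Measurable H) :
    ∫⁻ ω, H ((Z ω - v ω) / 2, M ω, v ω) ∂μ =
      ∫⁻ ω, (∫⁻ x, 2 * gaussianPDF 0 2 (2 * x + v ω) * H (x, M ω, v ω)) ∂μ := by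
  have hMv : Measurable fun ω => (M ω, v ω) := hM.prodMk hv
  have e := (indepFun_iff_map_prod_eq_prod_map_map hMv.aemeasurable hZm.aemeasurable).1 hind
  have hK : Measurable fun p : (ℝ × ℝ) × ℝ => H ((p.2 - p.1.2) / 2, p.1) := by
    refine hH.comp (Measurable.prodMk ?_ measurable_fst)
    fun_prop
  have h1 : ∫⁻ ω, H ((Z ω - v ω) / 2, M ω, v ω) ∂μ =
      ∫⁻ p, H ((p.2 - p.1.2) / 2, p.1) ∂(μ.map fun ω => ((M ω, v ω), Z ω)) :=
    (lintegral_map hK (hMv.prodMk hZm)).symm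
  rw [h1, e, lintegral_prod _ hK.aemeasurable, hZ, lintegral_map hK.lintegral_prod_right' hMv]
  refine lintegral_congr fun ω => ?_
  have hKω : Measurable fun z : ℝ => H ((z - v ω) / 2, M ω, v ω) :=
    hK.comp (measurable_prodMk_left (x := (M ω, v ω)))
  rw [gaussianReal_of_var_ne_zero 0 two_ne_zero,
    lintegral_withDensity_eq_lintegral_mul _ (measurable_gaussianPDF 0 2) hKω,
    lintegral_eq_two_mul_comp_affine ((measurable_gaussianPDF 0 2).mul hKω) (v ω)]
  refine lintegral_congr fun x => ?_
  simp only [Pi.mul_apply]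
  rw [show (2 * x + v ω - v ω) / 2 = x by ring, mul_assoc]

section Main

variable {Ω : Type*} [MeasurableSpace Ω] {μ : Measure Ω} {S : ℝ → Ω → ℝ}

theorem IsSlepian.indepFun_increment (hS : IsSlepian μ S) {s : ℝ} (hs : s ∈ Icc (0 : ℝ) 1) :
    IndepFun (fun ω (u : Icc 0 s) => slepComb S (u, -1, 0) ω) (slepComb S (1, -1, s)) μ := by
  refine (hS.indepFun_slepComb (T := Icc 0 s) (T' := Unit) (fun u => ((u : ℝ), -1, 0))
    (fun _ => (1, -1, s)) ?_).comp measurable_id (measurable_pi_apply ())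
  rintro ⟨u, hu0, hus⟩ -
  have h1 : |u - 1| = 1 - u := by rw [abs_sub_comm, abs_of_nonneg]; linarith [hs.2]
  have h2 : |u - s| = s - u := by rw [abs_sub_comm, abs_of_nonneg]; linarith
  have h3 : |(0 : ℝ) - 1| = 1 := by norm_num
  have h4 : |0 - s| = s := by rw [zero_sub, abs_neg, abs_of_nonneg hs.1]
  simp only [slepCombCov, h1, h2, h3, h4]
  rw [max_eq_right (by linarith), max_eq_right (by linarith [hs.2]), max_eq_right (by linarith),
    max_eq_right (by linarith [hs.2])]
  ring

theorem IsSlepian.map_increment_neg (hS : IsSlepian μ S) (s : ℝ) :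
    μ.map (slepComb S (1, -1, s)) = μ.map (fun ω => -slepComb S (1, -1, s) ω) := by
  have h : (fun ω => -slepComb S (1, -1, s) ω) = (fun x => -x) ∘ slepComb S (1, -1, s) := rfl
  rw [h, ← Measure.map_map measurable_neg (hS.measurable_slepComb _), hS.map_slepComb,
    gaussianReal_map_neg, neg_zero]

theorem IsSlepian.indepFun_sum_endpoints (hS : IsSlepian μ S) :
    IndepFun (fun ω (u : Icc (0 : ℝ) 1) => slepComb S (u, -1, 0) ω) (slepComb S (0, 1, 1)) μ := by
  refine (hS.indepFun_slepComb (T := Icc (0 : ℝ) 1) (T' := Unit) (fun u => ((u : ℝ), -1, 0))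
    (fun _ => (0, 1, 1)) ?_).comp measurable_id (measurable_pi_apply ())
  rintro ⟨u, hu0, hu1⟩ -
  have h1 : |u - 1| = 1 - u := by rw [abs_sub_comm, abs_of_nonneg]; linarith
  have h2 : |u - 0| = u := by rw [sub_zero, abs_of_nonneg hu0]
  simp only [slepCombCov, h1, h2]
  rw [max_eq_right (by linarith), max_eq_right (by linarith)]
  norm_num

theorem IsSlepian.measure_endpoints (hS : IsSlepian μ S) (h : ℝ) :
    μ {ω | S 0 ω ≤ h ∧ S 1 ω < h} = ENNReal.ofReal (stdCdf h ^ 2) := by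
  have hlaw (t : ℝ) : μ.map (S t) = gaussianReal 0 1 := by
    have e : S t = slepComb S (t, 0, 0) := by
      ext ω
      simp [slepComb]
    rw [e, hS.map_slepComb]
    simp [slepCombCov]
  have hind : IndepFun (S 0) (S 1) μ := by
    have := (hS.indepFun_slepComb (T := Unit) (T' := Unit) (fun _ => (0, 0, 0))
      (fun _ => (1, 0, 0)) (by simp [slepCombCov])).comp (measurable_pi_apply ())
        (measurable_pi_apply ())
    convert! this using 1 <;> ext ω <;> simp [slepComb]
  have e : {ω | S 0 ω ≤ h ∧ S 1 ω < h} = S 0 ⁻¹' Iic h ∩ S 1 ⁻¹' Iio h := rfl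
  have hna : NullSingletonClass (gaussianReal 0 1) := nullSingletonClass_gaussianReal one_ne_zero
  rw [e, hind.measure_inter_preimage_eq_mul _ _ measurableSet_Iic measurableSet_Iio,
    ← Measure.map_apply (hS.2.1 0) measurableSet_Iic,
    ← Measure.map_apply (hS.2.1 1) measurableSet_Iio, hlaw, hlaw,
    measure_congr Iio_ae_eq_Iic, gaussianReal_Iic, ← ENNReal.ofReal_mul (stdCdf_nonneg h), sq]

/-- The conditional density at `x` of `(Z - v) / 2`, where `Z` has law `N(0, 2)`. -/
noncomputable def halfKernel (x v : ℝ) : ENNReal := 2 * gaussianPDF 0 2 (2 * x + v)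

theorem measurable_halfKernel : Measurable (Function.uncurry halfKernel) :=
  ((measurable_gaussianPDF 0 2).comp (by fun_prop)).const_mul 2

theorem continuous_halfKernel (x : ℝ) : Continuous (halfKernel x) :=
  (ENNReal.continuous_const_mul (by simp)).comp
    ((continuous_gaussianPDF 0 2).comp (by fun_prop))

theorem halfKernel_le (x v : ℝ) : halfKernel x v ≤ 2 :=
  (mul_le_mul_right (gaussianPDF_le _) 2).trans (by simp)

theorem ae_ne_of_map_eq_gaussianReal {v : Ω → ℝ} (hv : Measurable v)
    (hlaw : μ.map v = gaussianReal 0 2) (m : ℝ) : ∀ᵐ ω ∂μ, v ω ≠ m := by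
  have hna : NullSingletonClass (gaussianReal 0 2) := nullSingletonClass_gaussianReal two_ne_zero
  have h1 : ∀ᵐ y ∂(μ.map v), y ≠ m := by
    rw [hlaw]
    exact Measure.ae_ne _ m
  exact ae_of_ae_map hv.aemeasurable h1

section HalfSub

variable {X Z M v : Ω → ℝ}

theorem measurable_halfKernel_mul_indicator (hM : Measurable M) (hv : Measurable v)
    {A : Set (ℝ × ℝ × ℝ)} (hA : MeasurableSet A) :
    Measurable fun p : ℝ × Ω =>
      halfKernel p.1 (v p.2) * A.indicator (1 : ℝ × ℝ × ℝ → ENNReal) (p.1, M p.2, v p.2) := by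
  have h1 : Measurable fun p : ℝ × Ω => halfKernel p.1 (v p.2) :=
    measurable_halfKernel.comp (f := fun p : ℝ × Ω => (p.1, v p.2))
      (measurable_fst.prodMk (hv.comp measurable_snd))
  have h2 : Measurable (A.indicator (1 : ℝ × ℝ × ℝ → ENNReal)) := measurable_one.indicator hA
  have h3 : Measurable fun p : ℝ × Ω => (p.1, M p.2, v p.2) :=
    measurable_fst.prodMk ((hM.comp measurable_snd).prodMk (hv.comp measurable_snd))
  exact h1.mul (h2.comp h3)

variable [IsProbabilityMeasure μ]

theorem measure_mem_eq_lintegral_halfKernel (hX : ∀ ω, (Z ω - v ω) / 2 = X ω)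
    (hZm : Measurable Z) (hM : Measurable M) (hv : Measurable v)
    (hZ : μ.map Z = gaussianReal 0 2) (hind : IndepFun (fun ω => (M ω, v ω)) Z μ)
    {A : Set (ℝ × ℝ × ℝ)} (hA : MeasurableSet A) :
    μ {ω | (X ω, M ω, v ω) ∈ A} =
      ∫⁻ ω, (∫⁻ x, halfKernel x (v ω) *
        A.indicator (1 : ℝ × ℝ × ℝ → ENNReal) (x, M ω, v ω)) ∂μ := by
  have hXm : Measurable X := by
    rw [← funext hX]
    exact (hZm.sub hv).div_const 2
  have hI : Measurable (A.indicator (1 : ℝ × ℝ × ℝ → ENNReal)) := measurable_one.indicator hA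
  have key := lintegral_half_sub_eq hZm hM hv hZ hind hI
  simp only [hX] at key
  have hXA : Measurable fun ω => (X ω, M ω, v ω) := hXm.prodMk (hM.prodMk hv)
  have hSA : MeasurableSet {ω | (X ω, M ω, v ω) ∈ A} := hXA hA
  rw [← lintegral_indicator_one hSA]
  exact key

theorem measure_mem_eq_lintegral_halfKernel' (hX : ∀ ω, (Z ω - v ω) / 2 = X ω)
    (hZm : Measurable Z) (hM : Measurable M) (hv : Measurable v)
    (hZ : μ.map Z = gaussianReal 0 2) (hind : IndepFun (fun ω => (M ω, v ω)) Z μ)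
    {A : Set (ℝ × ℝ × ℝ)} (hA : MeasurableSet A) :
    μ {ω | (X ω, M ω, v ω) ∈ A} =
      ∫⁻ x, ∫⁻ ω, halfKernel x (v ω) *
        A.indicator (1 : ℝ × ℝ × ℝ → ENNReal) (x, M ω, v ω) ∂μ := by
  rw [measure_mem_eq_lintegral_halfKernel hX hZm hM hv hZ hind hA, lintegral_lintegral_swap]
  exact ((measurable_halfKernel_mul_indicator hM hv hA).comp measurable_swap).aemeasurable

theorem measure_add_eq_eq_zero (hX : ∀ ω, (Z ω - v ω) / 2 = X ω)
    (hZm : Measurable Z) (hM : Measurable M) (hv : Measurable v)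
    (hZ : μ.map Z = gaussianReal 0 2) (hind : IndepFun (fun ω => (M ω, v ω)) Z μ) (h : ℝ) :
    μ {ω | X ω + M ω = h} = 0 := by
  have hA : MeasurableSet {p : ℝ × ℝ × ℝ | p.1 + p.2.1 = h} :=
    measurableSet_eq_fun (by fun_prop) measurable_const
  refine (measure_mem_eq_lintegral_halfKernel hX hZm hM hv hZ hind hA).trans ?_
  rw [← lintegral_zero (μ := μ)]
  refine lintegral_congr fun ω => ?_
  refine (lintegral_congr_ae ?_).trans lintegral_zero
  filter_upwards [Measure.ae_ne volume (h - M ω)] with x hx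
  rw [indicator_of_notMem, mul_zero]
  exact fun h' => hx (eq_sub_of_add_eq h')

end HalfSub

section Reflection

variable {V : ℝ → Ω → ℝ} {M : Ω → ℝ} [IsProbabilityMeasure μ]

theorem lintegral_halfKernel_reflection (hVm : ∀ t, Measurable (V t))
    (hVc : ∀ ω, Continuous fun t => V t ω) (hV0 : ∀ ω, V 0 ω = 0)
    (hVlaw : μ.map (V 1) = gaussianReal 0 2)
    (hind : ∀ s ∈ Icc (0 : ℝ) 1,
      IndepFun (fun ω (u : Icc 0 s) => V u ω) (fun ω => V 1 ω - V s ω) μ)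
    (hsym : ∀ s ∈ Icc (0 : ℝ) 1,
      μ.map (fun ω => V 1 ω - V s ω) = μ.map (fun ω => -(V 1 ω - V s ω)))
    (hMm : Measurable M) (hM : ∀ ω c, M ω ≤ c ↔ ∀ t ∈ Icc (0 : ℝ) 1, V t ω ≤ c) (h x : ℝ) :
    ∫⁻ ω, halfKernel x (V 1 ω) * {p : ℝ × ℝ × ℝ | p.1 + p.2.1 ≤ h}.indicator
          (1 : ℝ × ℝ × ℝ → ENNReal) (x, M ω, V 1 ω) ∂μ +
        ∫⁻ ω, (Ioc (h - V 1 ω) h).indicator 1 x * (2 * gaussianPDF 0 2 (2 * h - V 1 ω)) ∂μ =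
      ∫⁻ ω, halfKernel x (V 1 ω) * {p : ℝ × ℝ × ℝ | p.1 ≤ h ∧ p.1 + p.2.2 < h}.indicator
        (1 : ℝ × ℝ × ℝ → ENNReal) (x, M ω, V 1 ω) ∂μ := by
  have hatom := ae_ne_of_map_eq_gaussianReal (hVm 1) hVlaw
  have hA₁ : MeasurableSet {p : ℝ × ℝ × ℝ | p.1 + p.2.1 ≤ h} :=
    measurableSet_le (measurable_fst.add measurable_snd.fst) measurable_const
  have hmeas₁ : Measurable fun ω => halfKernel x (V 1 ω) *
      {p : ℝ × ℝ × ℝ | p.1 + p.2.1 ≤ h}.indicator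
        (1 : ℝ × ℝ × ℝ → ENNReal) (x, M ω, V 1 ω) := by
    have hjoint := measurable_halfKernel_mul_indicator hMm (hVm 1) hA₁
    exact hjoint.comp (f := fun ω => (x, ω)) measurable_prodMk_left
  rcases lt_or_ge h x with hx | hx
  · have e1 (ω : Ω) : {p : ℝ × ℝ × ℝ | p.1 + p.2.1 ≤ h}.indicator
        (1 : ℝ × ℝ × ℝ → ENNReal) (x, M ω, V 1 ω) = 0 := by
      have hpos : 0 ≤ M ω := by
        rw [← hV0 ω]
        exact (hM ω _).1 le_rfl 0 (by simp)
      have hnot : (x, M ω, V 1 ω) ∉ {p : ℝ × ℝ × ℝ | p.1 + p.2.1 ≤ h} := by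
        simp only [mem_ofPred_eq, not_le]
        linarith
      exact indicator_of_notMem hnot _
    have e2 (ω : Ω) : {p : ℝ × ℝ × ℝ | p.1 ≤ h ∧ p.1 + p.2.2 < h}.indicator
        (1 : ℝ × ℝ × ℝ → ENNReal) (x, M ω, V 1 ω) = 0 :=
      indicator_of_notMem (fun hmem => hx.not_ge hmem.1) _
    have e3 (ω : Ω) : (Ioc (h - V 1 ω) h).indicator (1 : ℝ → ENNReal) x = 0 :=
      indicator_of_notMem (fun hmem => hx.not_ge hmem.2) _
    simp [e1, e2, e3]
  · have hr := lintegral_reflection hVm hVc hV0 hind hsym (sub_nonneg.2 hx) (hatom _)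
      (continuous_halfKernel x) ENNReal.ofNat_ne_top (halfKernel_le x)
    have e1 : ∫⁻ ω, (Ioc (h - V 1 ω) h).indicator 1 x *
        (2 * gaussianPDF 0 2 (2 * h - V 1 ω)) ∂μ =
        ∫⁻ ω, (Ioi (h - x)).indicator (fun v => halfKernel x (2 * (h - x) - v)) (V 1 ω) ∂μ := by
      refine lintegral_congr fun ω => ?_
      by_cases hω : h - x < V 1 ω
      · rw [indicator_of_mem (show x ∈ Ioc (h - V 1 ω) h from ⟨sub_lt_comm.1 hω, hx⟩),
          indicator_of_mem (show V 1 ω ∈ Ioi (h - x) from hω), Pi.one_apply, one_mul]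
        simp only [halfKernel]
        rw [show 2 * x + (2 * (h - x) - V 1 ω) = 2 * h - V 1 ω by ring]
      · have hω' : x ∉ Ioc (h - V 1 ω) h := fun h' => hω (sub_lt_comm.1 h'.1)
        rw [indicator_of_notMem hω',
          indicator_of_notMem (show V 1 ω ∉ Ioi (h - x) from hω), zero_mul]
    rw [e1, ← hr, ← lintegral_add_left hmeas₁]
    refine lintegral_congr_ae ?_
    filter_upwards [hatom (h - x)] with ω hω
    have hM' : (∃ t ∈ Icc (0 : ℝ) 1, h - x < V t ω) ↔ ¬ x + M ω ≤ h := by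
      rw [← le_sub_iff_add_le', hM]
      push Not
      rfl
    have hV1 : V 1 ω ≤ M ω := (hM ω _).1 le_rfl 1 (by simp)
    simp only [indicator, mem_ofPred_eq, hM', mem_Iio, hx, true_and, Pi.one_apply]
    by_cases h1 : x + M ω ≤ h
    · have h2 : x + V 1 ω < h :=
        lt_of_le_of_ne (by linarith) fun heq => hω (eq_sub_of_add_eq' heq)
      simp [h1, h2]
    · by_cases h2 : x + V 1 ω < h <;> simp [h1, h2, lt_sub_iff_add_lt']

end Reflection

theorem lintegral_overshoot {v : Ω → ℝ} [IsProbabilityMeasure μ] (hv : Measurable v)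
    (hlaw : μ.map v = gaussianReal 0 2) (h : ℝ) :
    ∫⁻ x, ∫⁻ ω, (Ioc (h - v ω) h).indicator 1 x * (2 * gaussianPDF 0 2 (2 * h - v ω)) ∂μ =
      ENNReal.ofReal (stdPhi h * (h * stdCdf h + stdPhi h)) := by
  have hmeas : Measurable fun p : ℝ × Ω => (Ioc (h - v p.2) h).indicator (1 : ℝ → ENNReal) p.1 *
      (2 * gaussianPDF 0 2 (2 * h - v p.2)) := by
    have hset : MeasurableSet {p : ℝ × Ω | h - v p.2 < p.1 ∧ p.1 ≤ h} :=
      (measurableSet_lt (by fun_prop) measurable_fst).inter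
        (measurableSet_le measurable_fst measurable_const)
    refine Measurable.mul (measurable_one.indicator hset) ?_
    exact ((measurable_gaussianPDF 0 2).comp (by fun_prop)).const_mul 2
  have hmeas' : Measurable fun y : ℝ => 2 * gaussianPDF 0 2 (2 * h - y) * ENNReal.ofReal y :=
    (((measurable_gaussianPDF 0 2).comp (measurable_const.sub measurable_id)).const_mul 2).mul
      ENNReal.measurable_ofReal
  rw [lintegral_lintegral_swap hmeas.aemeasurable, ← lintegral_gaussianReal_reflected, ← hlaw,
    lintegral_map hmeas' hv]
  refine lintegral_congr fun ω => ?_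
  rw [lintegral_mul_const _ (measurable_one.indicator measurableSet_Ioc),
    lintegral_indicator_one measurableSet_Ioc, Real.volume_Ioc, sub_sub_cancel, mul_comm]

theorem IsSlepian.measure_lt_add_eq (hS : IsSlepian μ S) (h : ℝ) :
    μ {ω | ∀ t ∈ Icc (0 : ℝ) 1, S t ω < h} +
        ENNReal.ofReal (stdPhi h * (h * stdCdf h + stdPhi h)) =
      ENNReal.ofReal (stdCdf h ^ 2) := by
  have hprob := hS.1
  obtain ⟨V, hV⟩ : ∃ V : ℝ → Ω → ℝ, ∀ t, V t = slepComb S (t, -1, 0) := ⟨_, fun _ => rfl⟩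
  have hVS (t : ℝ) (ω : Ω) : V t ω = S t ω - S 0 ω := by
    simp only [hV, slepComb]
    ring
  have hVm (t : ℝ) : Measurable (V t) := hV t ▸ hS.measurable_slepComb _
  have hVc (ω : Ω) : Continuous fun t => V t ω := by
    simp only [hVS]
    exact (hS.2.2.1 ω).sub continuous_const
  have hV0 (ω : Ω) : V 0 ω = 0 := by simp [hVS]
  have hVlaw : μ.map (V 1) = gaussianReal 0 2 := by
    rw [hV, hS.map_slepComb]
    congr 1
    norm_num [slepCombCov]
  have hincr (s : ℝ) : (fun ω => V 1 ω - V s ω) = slepComb S (1, -1, s) := by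
    ext ω
    simp only [hV, slepComb]
    ring
  have hVind (s : ℝ) (hs : s ∈ Icc (0 : ℝ) 1) :
      IndepFun (fun ω (u : Icc 0 s) => V u ω) (fun ω => V 1 ω - V s ω) μ := by
    rw [hincr]
    simp only [hV]
    exact hS.indepFun_increment hs
  have hVsym (s : ℝ) (_ : s ∈ Icc (0 : ℝ) 1) :
      μ.map (fun ω => V 1 ω - V s ω) = μ.map (fun ω => -(V 1 ω - V s ω)) := by
    have e : (fun ω => -(V 1 ω - V s ω)) = fun ω => -slepComb S (1, -1, s) ω := by
      rw [← hincr]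
    rw [e, hincr, hS.map_increment_neg]
  obtain ⟨Z, hZ⟩ : ∃ Z : Ω → ℝ, Z = slepComb S (0, 1, 1) := ⟨_, rfl⟩
  have hZm : Measurable Z := hZ ▸ hS.measurable_slepComb _
  have hZlaw : μ.map Z = gaussianReal 0 2 := by
    rw [hZ, hS.map_slepComb]
    congr 1
    norm_num [slepCombCov]
  have hX (ω : Ω) : (Z ω - V 1 ω) / 2 = S 0 ω := by
    simp only [hZ, hVS, slepComb]
    ring
  obtain ⟨M, hMdef⟩ : ∃ M : Ω → ℝ, M = fun ω => unitSup fun t => V t ω := ⟨_, rfl⟩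
  have hMm : Measurable M := by
    rw [hMdef]
    exact measurable_unitSup.comp (measurable_pi_lambda _ fun t => hVm t)
  have hM (ω : Ω) (c : ℝ) : M ω ≤ c ↔ ∀ t ∈ Icc (0 : ℝ) 1, V t ω ≤ c := by
    rw [hMdef]
    exact unitSup_le_iff (hVc ω)
  have hind : IndepFun (fun ω => (M ω, V 1 ω)) Z μ := by
    rw [hMdef, hZ]
    simp only [hV]
    exact hS.indepFun_sum_endpoints.comp (φ := fun w => (unitSup w, w ⟨1, by simp⟩))
      (measurable_unitSup.prodMk (measurable_pi_apply _)) measurable_id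
  have hSω (ω : Ω) : (∀ t ∈ Icc (0 : ℝ) 1, S t ω < h) ↔ S 0 ω + M ω < h := by
    rw [← lt_sub_iff_add_lt', hMdef, unitSup_lt_iff (hVc ω)]
    simp only [hVS, sub_lt_sub_iff_right]
  have hle : μ {ω | ∀ t ∈ Icc (0 : ℝ) 1, S t ω < h} = μ {ω | S 0 ω + M ω ≤ h} := by
    refine measure_congr ?_
    have hne : ∀ᵐ ω ∂μ, S 0 ω + M ω ≠ h := by
      rw [ae_iff]
      simpa using measure_add_eq_eq_zero hX hZm hMm (hVm 1) hZlaw hind h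
    filter_upwards [hne] with ω hω
    exact propext ((hSω ω).trans ⟨le_of_lt, fun h' => lt_of_le_of_ne h' hω⟩)
  have hA₁ : MeasurableSet {p : ℝ × ℝ × ℝ | p.1 + p.2.1 ≤ h} :=
    measurableSet_le (measurable_fst.add measurable_snd.fst) measurable_const
  have hA₂ : MeasurableSet {p : ℝ × ℝ × ℝ | p.1 ≤ h ∧ p.1 + p.2.2 < h} :=
    (measurableSet_le measurable_fst measurable_const).inter
      (measurableSet_lt (measurable_fst.add measurable_snd.snd) measurable_const)
  have hends : μ {ω | S 0 ω ≤ h ∧ S 1 ω < h} =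
      μ {ω | (S 0 ω, M ω, V 1 ω) ∈ {p : ℝ × ℝ × ℝ | p.1 ≤ h ∧ p.1 + p.2.2 < h}} := by
    congr 1
    ext ω
    simp only [mem_ofPred_eq, hVS, add_sub_cancel]
  rw [hle, ← hS.measure_endpoints h, hends,
    measure_mem_eq_lintegral_halfKernel' hX hZm hMm (hVm 1) hZlaw hind hA₂,
    ← lintegral_overshoot (hVm 1) hVlaw h,
    ← lintegral_congr (lintegral_halfKernel_reflection hVm hVc hV0 hVlaw hVind hVsym hMm hM h),
    lintegral_add_left (measurable_halfKernel_mul_indicator hMm (hVm 1) hA₁).lintegral_prod_right',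
    ← measure_mem_eq_lintegral_halfKernel' hX hZm hMm (hVm 1) hZlaw hind hA₁]
  rfl

end Main

/-- Slepian's formula: `F_1(h) = Φ(h)² - φ(h)(hΦ(h) + φ(h))`. -/
theorem slepF_one {Ω : Type*} [MeasurableSpace Ω] (μ : Measure Ω)
    (S : ℝ → Ω → ℝ) (hS : IsSlepian μ S) (h : ℝ) :
    slepF μ S 1 h = stdCdf h ^ 2 - stdPhi h * (h * stdCdf h + stdPhi h) := by
  have hprob := hS.1
  have key := congrArg ENNReal.toReal (hS.measure_lt_add_eq h)
  rw [ENNReal.toReal_add (measure_ne_top _ _) ENNReal.ofReal_ne_top,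
    ENNReal.toReal_ofReal (mul_nonneg (stdPhi_nonneg h) (mul_stdCdf_add_stdPhi_nonneg h)),
    ENNReal.toReal_ofReal (sq_nonneg _)] at key
  rw [slepF]
  linarith
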